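/- arXiv:1801.04611 — 2 statements merged into one kernel-verified Lean document; each statement's English description precedes it below -/
import Mathlib

section
/- Let Γ be an additive subsemigroup of ℕ^d × ℕ and let P₁, …, Pₙ be valuative points of Γ. Then every rational point in the relative interior of the convex hull of {P₁, …, Pₙ} is a valuative point of Γ. -/
/-- The set of valuative points of an additive subsemigroup `Γ ⊆ ℕ^d × ℕ`:
points `x ∈ ℝ^d` of the form `σ / k` for some `(σ, k) ∈ Γ` with `k > 0`. -/
def valPoints {d : ℕ} (Γ : AddSubsemigroup ((Fin d → ℕ) × ℕ)) : Set (Fin d → ℝ) :=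
  {x | ∃ p ∈ Γ, 0 < p.2 ∧ x = fun i => (p.1 i : ℝ) / (p.2 : ℝ)}

theorem AddSubsemigroup.nsmul_mem_of_pos {M : Type*} [AddMonoid M] (S : AddSubsemigroup M)
    {p : M} (hp : p ∈ S) {n : ℕ} (hn : 0 < n) : n • p ∈ S := by
  induction n, hn using Nat.le_induction with
  | base => simpa using hp
  | succ n _ ih => rw [succ_nsmul]; exact S.add_mem ih hp

/-- Finitely many positive rationals have a common denominator with positive numerators. -/
theorem exists_common_den_of_pos {ι : Type*} [Fintype ι] (r : ι → ℚ) (hr : ∀ i, 0 < r i) :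
    ∃ N : ℕ, 0 < N ∧ ∃ m : ι → ℕ, ∀ i, 0 < m i ∧ (m i : ℚ) = N * r i := by
  have hN : 0 < ∏ i, (r i).den := Finset.prod_pos fun i _ => (r i).den_pos
  refine ⟨∏ i, (r i).den, hN, ?_⟩
  have key : ∀ i, ∃ m : ℕ, 0 < m ∧ (m : ℚ) = (∏ i, (r i).den : ℕ) * r i := by
    intro i
    obtain ⟨c, hc⟩ := Finset.dvd_prod_of_mem (fun i => (r i).den) (Finset.mem_univ i)
    have hnum : (((r i).num.toNat : ℕ) : ℚ) = (r i).num := by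
      exact_mod_cast Int.toNat_of_nonneg (Rat.num_pos.2 (hr i)).le
    have heq : ((c * (r i).num.toNat : ℕ) : ℚ) = (∏ i, (r i).den : ℕ) * r i := by
      rw [hc, Nat.cast_mul, hnum, Nat.cast_mul, ← Rat.mul_den_eq_num]
      ring
    refine ⟨_, ?_, heq⟩
    have : (0 : ℚ) < (∏ i, (r i).den : ℕ) * r i := mul_pos (by exact_mod_cast hN) (hr i)
    rw [← heq] at this
    exact_mod_cast this
  choose m hm using key
  exact ⟨m, hm⟩

/-- The weights of a rational point with respect to affinely independent rational points are
rational. -/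
theorem AffineIndependent.exists_rat_weights {κ ι : Type*} [Fintype ι] {z : ι → κ → ℝ}
    (hz : AffineIndependent ℝ z) (hzrat : ∀ i j, ∃ q : ℚ, z i j = q) {w : ι → ℝ}
    (hw : ∑ i, w i = 1) (hxrat : ∀ j, ∃ q : ℚ, (∑ i, w i • z i) j = q) :
    ∃ q : ι → ℚ, ∀ i, w i = q i := by
  obtain ⟨f, hf⟩ := (Algebra.linearMap ℚ ℝ).exists_leftInverse_of_injective
    (LinearMap.ker_eq_bot.2 (algebraMap ℚ ℝ).injective)
  have hf' (q : ℚ) : f (q : ℝ) = q := by simpa using LinearMap.congr_fun hf q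
  refine ⟨fun i => f (w i), fun i => ?_⟩
  have hsum : ∑ i, (w i - (f (w i) : ℝ)) = 0 := by
    rw [Finset.sum_sub_distrib, hw, ← Rat.cast_sum, ← map_sum, hw]
    have hf1 : f 1 = 1 := by simpa using hf' 1
    simp [hf1]
  have hcomb : ∑ i, (w i - (f (w i) : ℝ)) • z i = 0 := by
    ext j
    choose a ha using fun i => hzrat i j
    obtain ⟨b, hb⟩ := hxrat j
    simp only [Finset.sum_apply, Pi.smul_apply, smul_eq_mul, ha] at hb
    have hfb : ∑ i, f (w i) * a i = b := by
      rw [← hf' b, ← hb, map_sum]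
      refine Finset.sum_congr rfl fun i _ => ?_
      rw [mul_comm (w i), ← Rat.smul_def, map_smul, smul_eq_mul, mul_comm]
    simp only [Finset.sum_apply, Pi.smul_apply, smul_eq_mul, ha, sub_mul, Pi.zero_apply,
      Finset.sum_sub_distrib, hb]
    rw [← hfb]
    push_cast
    ring
  exact sub_eq_zero.1 (affineIndependent_iff.1 hz Finset.univ _ hsum hcomb i (Finset.mem_univ i))

theorem rat_of_mem_valPoints {d : ℕ} {Γ : AddSubsemigroup ((Fin d → ℕ) × ℕ)} {x : Fin d → ℝ}
    (hx : x ∈ valPoints Γ) (j : Fin d) : ∃ q : ℚ, x j = q := by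
  obtain ⟨p, -, -, rfl⟩ := hx
  exact ⟨(p.1 j : ℚ) / p.2, by push_cast; rfl⟩

/-- Valuative points are closed under convex combinations with positive rational weights. -/
theorem sum_smul_mem_valPoints {d : ℕ} {Γ : AddSubsemigroup ((Fin d → ℕ) × ℕ)} {ι : Type*}
    [Fintype ι] {z : ι → Fin d → ℝ} (hz : ∀ i, z i ∈ valPoints Γ) {q : ι → ℚ}
    (hq : ∀ i, 0 < q i) (hq1 : ∑ i, q i = 1) : ∑ i, (q i : ℝ) • z i ∈ valPoints Γ := by
  choose p hpΓ hp0 hpz using hz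
  have hne : (Finset.univ : Finset ι).Nonempty :=
    Finset.nonempty_of_sum_ne_zero (f := q) (by rw [hq1]; exact one_ne_zero)
  obtain ⟨N, hN, m, hm⟩ := exists_common_den_of_pos (fun i => q i / (p i).2)
    fun i => div_pos (hq i) (by exact_mod_cast hp0 i)
  have hp0' (i) : ((p i).2 : ℚ) ≠ 0 := by exact_mod_cast (hp0 i).ne'
  have hmem : ∑ i, m i • p i ∈ Γ :=
    Finset.sum_induction_nonempty _ (· ∈ Γ) (fun _ _ => Γ.add_mem) hne
      fun i _ => Γ.nsmul_mem_of_pos (hpΓ i) (hm i).1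
  have hsnd : (∑ i, m i • p i).2 = N := by
    have : ∑ i, (m i : ℚ) * (p i).2 = N := by
      rw [← mul_one (N : ℚ), ← hq1, Finset.mul_sum]
      refine Finset.sum_congr rfl fun i _ => ?_
      rw [(hm i).2, mul_assoc, div_mul_cancel₀ _ (hp0' i)]
    simp only [Prod.snd_sum, Prod.smul_snd, smul_eq_mul]
    exact_mod_cast this
  refine ⟨_, hmem, hsnd ▸ hN, ?_⟩
  ext j
  have hN' : (N : ℝ) ≠ 0 := by exact_mod_cast hN.ne'
  rw [hsnd, eq_div_iff hN']
  simp only [Prod.fst_sum, Prod.smul_fst, Finset.sum_apply, Pi.smul_apply, smul_eq_mul,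
    Nat.cast_sum, Nat.cast_mul, Finset.sum_mul]
  refine Finset.sum_congr rfl fun i _ => ?_
  have hmi : (m i : ℝ) = N * (q i / (p i).2) := by
    exact_mod_cast congrArg (Rat.cast (K := ℝ)) (hm i).2
  rw [hmi, hpz i]
  ring


/-- if `P₁, …, Pₙ` are valuative points of `Γ`, then every rational point
in the relative (intrinsic) interior of the convex hull of `{P₁, …, Pₙ}` is a valuative
point of `Γ`. -/
theorem rational_relint_hull_points_valuative {d n : ℕ} (hd : 1 ≤ d)
    (Γ : AddSubsemigroup ((Fin d → ℕ) × ℕ)) (P : Fin n → (Fin d → ℝ))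
    (hP : ∀ i, P i ∈ valPoints Γ)
    (x : Fin d → ℝ) (hx : x ∈ intrinsicInterior ℝ (convexHull ℝ (Set.range P)))
    (hxrat : ∀ i, ∃ q : ℚ, x i = (q : ℝ)) :
    x ∈ valPoints Γ := by
  obtain ⟨ι, _, z, w, hzP, hz, hw, hw1, rfl⟩ :=
    eq_pos_convex_span_of_mem_convexHull (intrinsicInterior_subset hx)
  have hzΓ (i) : z i ∈ valPoints Γ := by
    obtain ⟨k, hk⟩ := hzP (Set.mem_range_self i)
    exact hk ▸ hP k
  obtain ⟨q, hq⟩ := hz.exists_rat_weights (fun i => rat_of_mem_valPoints (hzΓ i)) hw1 hxrat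
  simp only [hq] at hw hw1 ⊢
  exact sum_smul_mem_valPoints hzΓ (fun i => by exact_mod_cast hw i) (by exact_mod_cast hw1)
end

section
/- Let Γ be an additive subsemigroup of ℕ^d × ℕ such that every nonzero element of Γ has positive last coordinate, and suppose the Newton–Okounkov body Δ(Γ) is a rational polytope, i.e. the convex hull of finitely many points of ℝ^d with rational coordinates. Then Γ is finitely generated as an additive semigroup if and only if every rational point of Δ(Γ) is a valuative point of Γ. -/
/-- The Newton–Okounkov body of `Γ`: the closure of the convex hull of the set of
valuative points of `Γ`. -/
def NObody {d : ℕ} (Γ : AddSubsemigroup ((Fin d → ℕ) × ℕ)) : Set (Fin d → ℝ) :=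
  closure (convexHull ℝ (valPoints Γ))

/-- The point `σ / k` attached to a pair `(σ, k)`. -/
noncomputable def ratioPoint {d : ℕ} (p : (Fin d → ℕ) × ℕ) : Fin d → ℝ :=
  fun i => (p.1 i : ℝ) / (p.2 : ℝ)

theorem mem_valPoints_iff {d : ℕ} {Γ : AddSubsemigroup ((Fin d → ℕ) × ℕ)} {x : Fin d → ℝ} :
    x ∈ valPoints Γ ↔ ∃ p ∈ Γ, 0 < p.2 ∧ x = ratioPoint p := Iff.rfl

theorem exists_sum_smul_of_mem_convexHull_range {ι E : Type*} [Fintype ι] [AddCommGroup E]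
    [Module ℝ E] (v : ι → E) {x : E} (hx : x ∈ convexHull ℝ (Set.range v)) :
    ∃ c : ι → ℝ, (∀ i, 0 ≤ c i) ∧ ∑ i, c i = 1 ∧ ∑ i, c i • v i = x := by
  classical
  have hv : Set.range v = Fintype.linearCombination ℝ v ''
      Set.range fun i j : ι => if i = j then (1 : ℝ) else 0 := by
    rw [← Set.range_comp]
    congr 1
    ext i
    simp [Fintype.linearCombination_apply]
  rw [hv, ← LinearMap.image_convexHull, convexHull_basis_eq_stdSimplex] at hx
  obtain ⟨c, hc, rfl⟩ := hx
  exact ⟨c, hc.1, hc.2, (Fintype.linearCombination_apply ℝ v c).symm⟩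

/-- A point in the convex hull of ratio points lifts to the cone over the corresponding pairs. -/
theorem exists_cone_coeff {d : ℕ} {ι : Type*} [Fintype ι] (v : ι → (Fin d → ℕ) × ℕ)
    (hv : ∀ i, 0 < (v i).2) {x : Fin d → ℝ}
    (hx : x ∈ convexHull ℝ (Set.range fun i => ratioPoint (v i))) :
    ∃ c : ι → ℝ, (∀ i, 0 ≤ c i) ∧ ∑ i, c i * ((v i).2 : ℝ) = 1 ∧
      ∀ j, ∑ i, c i * ((v i).1 j : ℝ) = x j := by
  obtain ⟨c, hc0, hc1, rfl⟩ := exists_sum_smul_of_mem_convexHull_range _ hx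
  refine ⟨fun i => c i / (v i).2, fun i => div_nonneg (hc0 i) (Nat.cast_nonneg _), ?_, ?_⟩
  · rw [← hc1]
    refine Finset.sum_congr rfl fun i _ => ?_
    have : ((v i).2 : ℝ) ≠ 0 := by exact_mod_cast (hv i).ne'
    field_simp
  · intro j
    rw [Finset.sum_apply]
    refine Finset.sum_congr rfl fun i _ => ?_
    simp only [Pi.smul_apply, smul_eq_mul, ratioPoint]
    ring

/-- Finitely many positive reals can be made positive rationals by a `ℚ`-linear functional. -/
theorem exists_rat_linear_pos (F : Finset ℝ) :
    ∃ φ : ℝ →ₗ[ℚ] ℚ, ∀ c ∈ F, 0 < c → 0 < φ c := by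
  let B := Module.Basis.ofVectorSpace ℚ ℝ
  let g : ℝ → (Module.Basis.ofVectorSpaceIndex ℚ ℝ → ℝ) → ℝ := fun c t =>
    (B.repr c).sum fun k a => (a : ℝ) * t k
  have hg : ∀ c, Continuous (g c) := fun c =>
    continuous_finsetSum _ fun k _ => continuous_const.mul (continuous_apply k)
  have hB : ∀ c, g c (fun k => B k) = c := by
    intro c
    conv_rhs => rw [← B.linearCombination_repr c, Finsupp.linearCombination_apply]
    simp only [g, Rat.smul_def]
  let U : Set (Module.Basis.ofVectorSpaceIndex ℚ ℝ → ℝ) :=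
    ⋂ c ∈ F.filter (0 < ·), {t | 0 < g c t}
  have hU : IsOpen U :=
    isOpen_biInter_finset fun c _ => isOpen_lt continuous_const (hg c)
  have hUne : U.Nonempty := by
    refine ⟨fun k => B k, ?_⟩
    simp only [U, Set.mem_iInter, Finset.mem_filter]
    intro c hc
    show 0 < g c _
    rw [hB]
    exact hc.2
  have hd : DenseRange (Pi.map fun (_ : Module.Basis.ofVectorSpaceIndex ℚ ℝ) (q : ℚ) => (q : ℝ)) :=
    DenseRange.piMap fun _ => Rat.denseRange_cast
  obtain ⟨t, ht⟩ := hd.exists_mem_open hU hUne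
  refine ⟨B.constr ℚ t, fun c hc hc0 => ?_⟩
  simp only [U, Set.mem_iInter, Finset.mem_filter] at ht
  have h : 0 < g c (Pi.map (fun _ (q : ℚ) => (q : ℝ)) t) := ht c ⟨hc, hc0⟩
  have he : g c (Pi.map (fun _ (q : ℚ) => (q : ℝ)) t) = ((B.constr ℚ t c : ℚ) : ℝ) := by
    rw [Module.Basis.constr_apply]
    simp [g, Finsupp.sum]
  rw [he] at h
  exact_mod_cast h

theorem exists_nat_mul_eq_natCast {ι : Type*} [Fintype ι] (q : ι → ℚ) (hq : ∀ i, 0 ≤ q i) :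
    ∃ (D : ℕ) (n : ι → ℕ), 0 < D ∧ ∀ i, (D : ℚ) * q i = n i := by
  classical
  refine ⟨∏ i, (q i).den, fun i => (q i).num.toNat * ∏ k ∈ Finset.univ.erase i, (q k).den,
    Finset.prod_pos fun i _ => (q i).den_pos, fun i => ?_⟩
  have hnum : (((q i).num.toNat : ℕ) : ℚ) = (q i).num := by
    exact_mod_cast congrArg (Int.cast : ℤ → ℚ) (Int.toNat_of_nonneg (Rat.num_nonneg.2 (hq i)))
  rw [← Finset.mul_prod_erase Finset.univ (fun i => (q i).den) (Finset.mem_univ i), Nat.cast_mul,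
    Nat.cast_mul, hnum, ← Rat.mul_den_eq_num (q i)]
  ring

theorem add_sum_nsmul_mem {M ι : Type*} [AddCommMonoid M] (Γ : AddSubsemigroup M) (v : ι → M)
    (hv : ∀ i, v i ∈ Γ) (n : ι → ℕ) (s : Finset ι) {a : M} (ha : a ∈ Γ) :
    a + ∑ i ∈ s, n i • v i ∈ Γ := by
  classical
  have key : ∀ (k : ℕ) (i : ι) (b : M), b ∈ Γ → b + k • v i ∈ Γ := by
    intro k i
    induction k with
    | zero => intro b hb; simpa using hb
    | succ k ih =>
      intro b hb
      rw [succ_nsmul, ← add_assoc]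
      exact Γ.add_mem (ih b hb) (hv i)
  induction s using Finset.induction_on with
  | empty => simpa using ha
  | insert i s hi ih =>
    rw [Finset.sum_insert hi, add_comm (n i • v i), ← add_assoc]
    exact key _ _ _ ih

theorem sum_nsmul_mem_of_ne_zero {M ι : Type*} [AddCommMonoid M] (Γ : AddSubsemigroup M)
    (v : ι → M) (hv : ∀ i, v i ∈ Γ) (n : ι → ℕ) (s : Finset ι)
    (h : ∑ i ∈ s, n i • v i ≠ 0) : ∑ i ∈ s, n i • v i ∈ Γ := by
  classical
  obtain ⟨i, hi, hne⟩ := Finset.exists_ne_zero_of_sum_ne_zero h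
  obtain ⟨k, hk⟩ : ∃ k, n i = k + 1 :=
    Nat.exists_eq_succ_of_ne_zero fun h0 => hne (by simp [h0])
  have := add_sum_nsmul_mem Γ v hv (Function.update n i k) s (hv i)
  convert this using 1
  rw [← Finset.add_sum_erase s _ hi, ← Finset.add_sum_erase s _ hi, hk, Function.update_self,
    succ_nsmul, add_comm (k • v i), add_assoc]
  congr 2
  refine Finset.sum_congr rfl fun j hj => ?_
  rw [Function.update_of_ne (Finset.ne_of_mem_erase hj)]

theorem ratioPoint_add_mem {d : ℕ} {C : Set (Fin d → ℝ)} (hC : Convex ℝ C)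
    {p q : (Fin d → ℕ) × ℕ} (hp : 0 < p.2) (hq : 0 < q.2) (hpC : ratioPoint p ∈ C)
    (hqC : ratioPoint q ∈ C) : ratioPoint (p + q) ∈ C := by
  have hp' : (0 : ℝ) < p.2 := by exact_mod_cast hp
  have hq' : (0 : ℝ) < q.2 := by exact_mod_cast hq
  convert hC hpC hqC (a := p.2 / (p.2 + q.2)) (b := q.2 / (p.2 + q.2)) (by positivity)
    (by positivity) (by field_simp) using 1
  ext i
  simp only [ratioPoint, Prod.fst_add, Prod.snd_add, Pi.add_apply, Nat.cast_add, Pi.smul_apply,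
    smul_eq_mul]
  field_simp

theorem NObody_closure_subset {d : ℕ} (S : Finset ((Fin d → ℕ) × ℕ))
    (hS : ∀ p ∈ S, p ≠ 0 → 0 < p.2) :
    NObody (AddSubsemigroup.closure (S : Set ((Fin d → ℕ) × ℕ))) ⊆
      convexHull ℝ (Set.range fun i : {p // p ∈ S ∧ 0 < p.2} => ratioPoint i.1) := by
  have : Finite {p // p ∈ S ∧ 0 < p.2} :=
    (S.finite_toSet.subset fun p (hp : p ∈ S ∧ 0 < p.2) => hp.1).to_subtype
  refine closure_minimal (convexHull_min ?_ (convex_convexHull ℝ _))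
    ((Set.finite_range _).isClosed_convexHull ℝ)
  intro x hx
  obtain ⟨p, hp, hp0, rfl⟩ := mem_valPoints_iff.1 hx
  have key : p = 0 ∨ 0 < p.2 ∧ ratioPoint p ∈
      convexHull ℝ (Set.range fun i : {p // p ∈ S ∧ 0 < p.2} => ratioPoint i.1) := by
    clear hp0 hx
    induction hp using AddSubsemigroup.closure_induction with
    | mem p hp =>
      by_cases h : p = 0
      · exact Or.inl h
      · exact Or.inr ⟨hS p hp h, subset_convexHull ℝ _ ⟨⟨p, hp, hS p hp h⟩, rfl⟩⟩
    | add p q _ _ ihp ihq =>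
      rcases ihp with rfl | ihp
      · simpa using ihq
      · rcases ihq with rfl | ihq
        · simpa using Or.inr ihp
        · exact Or.inr ⟨by simpa using Or.inl ihp.1,
            ratioPoint_add_mem (convex_convexHull ℝ _) ihp.1 ihq.1 ihp.2 ihq.2⟩
  rcases key with rfl | h
  · exact absurd hp0 (lt_irrefl 0)
  · exact h.2

/-- A rational point in the convex hull of finitely many valuative points is valuative. -/
theorem mem_valPoints_of_mem_convexHull {d : ℕ} (Γ : AddSubsemigroup ((Fin d → ℕ) × ℕ))
    {ι : Type*} [Fintype ι] (v : ι → (Fin d → ℕ) × ℕ) (hvΓ : ∀ i, v i ∈ Γ)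
    (hv : ∀ i, 0 < (v i).2) {x : Fin d → ℝ} (hxq : ∀ i, ∃ q : ℚ, x i = (q : ℝ))
    (hx : x ∈ convexHull ℝ (Set.range fun i => ratioPoint (v i))) : x ∈ valPoints Γ := by
  classical
  obtain ⟨c, hc0, hc1, hcx⟩ := exists_cone_coeff v hv hx
  choose y hy using hxq
  obtain ⟨φ, hφ⟩ := exists_rat_linear_pos (insert 1 (Finset.univ.image c))
  have hφ1 : 0 < φ 1 := hφ 1 (by simp) one_pos
  have hφc : ∀ i, 0 ≤ φ (c i) := by
    intro i
    rcases (hc0 i).eq_or_lt with h | h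
    · simp [← h]
    · exact (hφ _ (by simp) h).le
  have hφr : ∀ (a : ℝ) (q : ℚ), φ (a * (q : ℝ)) = φ a * q := by
    intro a q
    rw [mul_comm a, ← Rat.smul_def, map_smul, smul_eq_mul, mul_comm]
  have hφn : ∀ (a : ℝ) (k : ℕ), φ (a * (k : ℝ)) = φ a * k := by
    intro a k
    exact_mod_cast hφr a k
  obtain ⟨D, n, hD, hn⟩ := exists_nat_mul_eq_natCast (fun i => φ (c i)) hφc
  have h2 : ((∑ i, n i • v i).2 : ℚ) = D * φ 1 := by
    rw [← hc1, map_sum, Finset.mul_sum, Prod.snd_sum, Nat.cast_sum]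
    refine Finset.sum_congr rfl fun i _ => ?_
    rw [hφn, ← mul_assoc, hn]
    simp
  have h1 : ∀ j, ((∑ i, n i • v i).1 j : ℚ) = D * φ 1 * y j := by
    intro j
    have : φ (x j) = φ 1 * y j := by rw [hy, ← hφr, one_mul]
    rw [mul_assoc, ← this, ← hcx, map_sum, Finset.mul_sum, Prod.fst_sum, Finset.sum_apply,
      Nat.cast_sum]
    refine Finset.sum_congr rfl fun i _ => ?_
    rw [hφn, ← mul_assoc, hn]
    simp
  have hDq : (0 : ℚ) < D := by exact_mod_cast hD
  have hpos : 0 < (∑ i, n i • v i).2 := by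
    have : (0 : ℚ) < ((∑ i, n i • v i).2 : ℚ) := by rw [h2]; positivity
    exact_mod_cast this
  refine mem_valPoints_iff.2 ⟨∑ i, n i • v i,
    sum_nsmul_mem_of_ne_zero Γ v hvΓ n _ fun h => by rw [h] at hpos; exact hpos.false, hpos, ?_⟩
  ext j
  have : y j = ((∑ i, n i • v i).1 j : ℚ) / ((∑ i, n i • v i).2 : ℚ) := by
    rw [h1, h2]
    field_simp
  rw [hy, this, ratioPoint]
  push_cast
  rfl

/-- Every nonnegative real combination of `v` lying in the lattice is a natural combination of `v`
plus a lattice point of the box bounded by `∑ i, v i`. -/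
theorem exists_floor_decomposition {d : ℕ} {ι : Type*} [Fintype ι] (v : ι → (Fin d → ℕ) × ℕ)
    (p : (Fin d → ℕ) × ℕ) (c : ι → ℝ) (hc : ∀ i, 0 ≤ c i)
    (h2 : ∑ i, c i * ((v i).2 : ℝ) = p.2) (h1 : ∀ j, ∑ i, c i * ((v i).1 j : ℝ) = p.1 j) :
    ∃ (n : ι → ℕ) (r : (Fin d → ℕ) × ℕ), r ≤ ∑ i, v i ∧ p = r + ∑ i, n i • v i := by
  have scalar : ∀ (a : ι → ℕ) (m : ℕ), ∑ i, c i * (a i : ℝ) = m →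
      ∑ i, ⌊c i⌋₊ * a i ≤ m ∧ m ≤ ∑ i, a i + ∑ i, ⌊c i⌋₊ * a i := by
    intro a m h
    constructor
    · have : ((∑ i, ⌊c i⌋₊ * a i : ℕ) : ℝ) ≤ m := by
        rw [← h]
        push_cast
        exact Finset.sum_le_sum fun i _ =>
          mul_le_mul_of_nonneg_right (Nat.floor_le (hc i)) (Nat.cast_nonneg _)
      exact_mod_cast this
    · have : (m : ℝ) ≤ ((∑ i, a i + ∑ i, ⌊c i⌋₊ * a i : ℕ) : ℝ) := by
        rw [← h, ← Finset.sum_add_distrib]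
        push_cast
        refine Finset.sum_le_sum fun i _ => ?_
        have := mul_le_mul_of_nonneg_right (Nat.lt_floor_add_one (c i)).le
          (Nat.cast_nonneg (α := ℝ) (a i))
        linarith
      exact_mod_cast this
  have e1 : ∀ j, (∑ i, ⌊c i⌋₊ • v i).1 j = ∑ i, ⌊c i⌋₊ * (v i).1 j := by
    simp [Prod.fst_sum, Finset.sum_apply]
  have e2 : (∑ i, ⌊c i⌋₊ • v i).2 = ∑ i, ⌊c i⌋₊ * (v i).2 := by
    simp [Prod.snd_sum]
  have s1 := fun j => scalar (fun i => (v i).1 j) (p.1 j) (h1 j)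
  have s2 := scalar (fun i => (v i).2) p.2 h2
  refine ⟨fun i => ⌊c i⌋₊, p - ∑ i, ⌊c i⌋₊ • v i, ⟨fun j => ?_, ?_⟩, Prod.ext (funext fun j => ?_) ?_⟩
  · rw [Prod.fst_sub, Pi.sub_apply, e1, Prod.fst_sum, Finset.sum_apply]
    change (_ : ℕ) ≤ _
    have := s1 j
    omega
  · rw [Prod.snd_sub, e2, Prod.snd_sum]
    omega
  · rw [Prod.fst_add, Pi.add_apply, Prod.fst_sub, Pi.sub_apply, e1]
    have := s1 j
    omega
  · rw [Prod.snd_add, Prod.snd_sub, e2]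
    omega

/-- A subsemigroup containing `v i` for all `i`, each of whose elements is a natural combination of
the `v i` plus an element of a fixed finite set, is finitely generated. -/
theorem exists_finset_closure_eq {M ι : Type*} [AddCommMonoid M] [Finite ι]
    (Γ : AddSubsemigroup M) (v : ι → M) (hv : ∀ i, v i ∈ Γ) (s : Finset ι) {R : Set M}
    (hR : R.Finite) (h : ∀ p ∈ Γ, ∃ (n : ι → ℕ), ∃ r ∈ R, p = r + ∑ i ∈ s, n i • v i) :
    ∃ S : Finset M, Γ = AddSubsemigroup.closure (S : Set M) := by
  let T : M → (ι → ℕ) → Prop := fun r n => r + ∑ i ∈ s, n i • v i ∈ Γ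
  have hT : ∀ r, {n | Minimal (T r) n}.Finite := fun r =>
    WellQuasiOrderedLE.finite_of_isAntichain (setOfPred_minimal_antichain _)
  let G : Set M := Set.range v ∪ ⋃ r ∈ R, (fun n => r + ∑ i ∈ s, n i • v i) '' {n | Minimal (T r) n}
  have hG : G.Finite :=
    (Set.finite_range v).union (hR.biUnion fun r _ => (hT r).image _)
  refine ⟨hG.toFinset, le_antisymm ?_ ?_⟩
  · intro p hp
    rw [hG.coe_toFinset]
    obtain ⟨n, r, hr, rfl⟩ := h p hp
    obtain ⟨m, hmn, hm⟩ := exists_minimal_le_of_wellFoundedLT (T r) n hp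
    have hsplit : r + ∑ i ∈ s, n i • v i =
        (r + ∑ i ∈ s, m i • v i) + ∑ i ∈ s, (n i - m i) • v i := by
      rw [add_assoc, ← Finset.sum_add_distrib]
      congr 1
      refine Finset.sum_congr rfl fun i _ => ?_
      rw [← add_nsmul, Nat.add_sub_cancel' (hmn i)]
    rw [hsplit]
    refine add_sum_nsmul_mem _ v (fun i => AddSubsemigroup.subset_closure (Or.inl ⟨i, rfl⟩)) _ s
      (AddSubsemigroup.subset_closure (Or.inr ?_))
    exact Set.mem_biUnion hr ⟨m, hm, rfl⟩
  · rw [AddSubsemigroup.closure_le, hG.coe_toFinset]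
    rintro p (⟨i, rfl⟩ | hp)
    · exact hv i
    · obtain ⟨r, -, m, hm, rfl⟩ := Set.mem_iUnion₂.1 hp
      exact hm.prop

/-- suppose every nonzero element of `Γ` has positive last coordinate and
`Δ(Γ)` is a rational polytope (the convex hull of finitely many rational points).
Then `Γ` is finitely generated as an additive semigroup if and only if every rational
point of `Δ(Γ)` is a valuative point of `Γ`. -/
theorem fg_iff_rational_points_valuative {d : ℕ} (hd : 1 ≤ d)
    (Γ : AddSubsemigroup ((Fin d → ℕ) × ℕ))
    (hpos : ∀ p ∈ Γ, p ≠ 0 → 0 < p.2)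
    (hpoly : ∃ (n : ℕ) (w : Fin n → (Fin d → ℚ)),
      NObody Γ = convexHull ℝ (Set.range fun i => fun j => ((w i j : ℝ)))) :
    (∃ S : Finset ((Fin d → ℕ) × ℕ),
        Γ = AddSubsemigroup.closure (S : Set ((Fin d → ℕ) × ℕ))) ↔
      (∀ x ∈ NObody Γ, (∀ i, ∃ q : ℚ, x i = (q : ℝ)) → x ∈ valPoints Γ) := by
  constructor
  · rintro ⟨S, rfl⟩ x hx hxq
    have hS : ∀ p ∈ S, p ≠ 0 → 0 < p.2 := fun p hp =>
      hpos p (AddSubsemigroup.subset_closure hp)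
    have : Finite {p // p ∈ S ∧ 0 < p.2} :=
      (S.finite_toSet.subset fun p (hp : p ∈ S ∧ 0 < p.2) => hp.1).to_subtype
    have := Fintype.ofFinite {p // p ∈ S ∧ 0 < p.2}
    exact mem_valPoints_of_mem_convexHull _ (fun i : {p // p ∈ S ∧ 0 < p.2} => i.1)
      (fun i => AddSubsemigroup.subset_closure i.2.1) (fun i => i.2.2) hxq
      (NObody_closure_subset S hS hx)
  · intro hval
    classical
    obtain ⟨n, w, hw⟩ := hpoly
    have hwval : ∀ i, (fun j => (w i j : ℝ)) ∈ valPoints Γ := fun i =>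
      hval _ (hw ▸ subset_convexHull ℝ _ ⟨i, rfl⟩) fun j => ⟨w i j, rfl⟩
    choose v hvΓ hv0 hvw using fun i => mem_valPoints_iff.1 (hwval i)
    refine exists_finset_closure_eq Γ v hvΓ Finset.univ (Set.finite_Icc 0 (∑ i, v i)) fun p hp => ?_
    suffices hc : ∃ c : Fin n → ℝ, (∀ i, 0 ≤ c i) ∧ ∑ i, c i * ((v i).2 : ℝ) = p.2 ∧
        ∀ j, ∑ i, c i * ((v i).1 j : ℝ) = p.1 j by
      obtain ⟨c, hc0, hc2, hc1⟩ := hc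
      obtain ⟨m, r, hr, hm⟩ := exists_floor_decomposition v p c hc0 hc2 hc1
      exact ⟨m, r, ⟨zero_le, hr⟩, hm⟩
    by_cases h0 : p = 0
    · exact ⟨0, by simp [h0]⟩
    have hp2 := hpos p hp h0
    have hpr : (p.2 : ℝ) ≠ 0 := by exact_mod_cast hp2.ne'
    have hmem : ratioPoint p ∈ NObody Γ :=
      subset_closure (subset_convexHull ℝ _ ⟨p, hp, hp2, rfl⟩)
    rw [hw, funext hvw] at hmem
    obtain ⟨c, hc0, hc2, hc1⟩ := exists_cone_coeff v hv0 hmem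
    refine ⟨fun i => p.2 * c i, fun i => mul_nonneg (Nat.cast_nonneg _) (hc0 i), ?_, fun j => ?_⟩
    · simp only [mul_assoc, ← Finset.mul_sum, hc2, mul_one]
    · simp only [mul_assoc, ← Finset.mul_sum, hc1, ratioPoint]
      field_simp
end
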